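/- Let R be a standard graded K-algebra, F a finitely generated graded free R-module with homogeneous basis e_1, …, e_s, and N ⊆ F a graded submodule. Then there exists a minimal set of homogeneous generators x_1, …, x_t of N, with x_i = Σ_{j=1}^s a_{ij} e_j and homogeneous coefficients a_{ij} ∈ R (with the convention deg a = ∞ for a = 0), such that ρ(N,F) ≥ max_{i=1,…,t} min_{j=1,…,s} deg a_{ij}. -/

import Mathlib

open Submodule

section

variable {K A : Type*} [Field K] [CommRing A] [Algebra K A]

/-- The graded maximal ideal `m = A_+` of a (standard) graded `K`-algebra `A`,
generated by the elements of positive degree. -/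
def gradedMaxIdeal (𝒜 : ℕ → Submodule K A) : Ideal A :=
  Ideal.span (⋃ i : ℕ, (𝒜 (i + 1) : Set A))

/-- The homogeneous elements of degree `t` of the graded free module `F = ⊕_j A e_j`
over the graded algebra `A`, where the basis element `e_j` has degree `d j`:
componentwise, the `j`-th coordinate must be homogeneous of degree `t - d j`
(and `0` if `t < d j`). -/
def freeHomPiece (𝒜 : ℕ → Submodule K A) {s : ℕ} (d : Fin s → ℕ) (t : ℕ) :
    Submodule K (Fin s → A) :=
  Submodule.pi Set.univ fun j => if d j ≤ t then 𝒜 (t - d j) else ⊥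

/-- The Artin–Rees number `ρ(N, P)` with respect to an ideal `m`. -/
noncomputable def artinReesNumber {R : Type*} [CommRing R] {M : Type*} [AddCommGroup M]
    [Module R M] (m : Ideal R) (N P : Submodule R M) : ℕ :=
  sInf {r : ℕ | ∀ i : ℕ, r ≤ i → N ⊓ m ^ i • P = m ^ (i - r) • (N ⊓ m ^ r • P)}

end

section

variable {K A : Type*} [Field K] [CommRing A] [Algebra K A]

theorem artinReesNumber_spec {R : Type*} [CommRing R] [IsNoetherianRing R] {M : Type*}
    [AddCommGroup M] [Module R M] [Module.Finite R M] (m : Ideal R) (N : Submodule R M)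
    {i : ℕ} (hi : artinReesNumber m N ⊤ ≤ i) :
    N ⊓ m ^ i • ⊤ = m ^ (i - artinReesNumber m N ⊤) •
      (N ⊓ m ^ artinReesNumber m N ⊤ • (⊤ : Submodule R M)) := by
  have hne : {r : ℕ | ∀ i : ℕ, r ≤ i →
      N ⊓ m ^ i • (⊤ : Submodule R M) = m ^ (i - r) • (N ⊓ m ^ r • ⊤)}.Nonempty := by
    obtain ⟨k, hk⟩ := Ideal.exists_pow_inf_eq_pow_smul m N
    exact ⟨k, fun i hi => by simpa only [inf_comm] using hk i hi⟩
  exact Nat.sInf_mem hne i hi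

theorem mem_freeHomPiece {𝒜 : ℕ → Submodule K A} {s : ℕ} {d : Fin s → ℕ} {t : ℕ}
    {y : Fin s → A} :
    y ∈ freeHomPiece 𝒜 d t ↔ ∀ j, y j ∈ if d j ≤ t then 𝒜 (t - d j) else ⊥ := by
  simp [freeHomPiece, Submodule.mem_pi]

theorem mem_gradedMaxIdeal_pow (𝒜 : ℕ → Submodule K A)
    (hstd : ∀ n : ℕ, 𝒜 (n + 1) = 𝒜 n * 𝒜 1) (n : ℕ) {a : A} (ha : a ∈ 𝒜 n) :
    a ∈ gradedMaxIdeal 𝒜 ^ n := by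
  induction n generalizing a with
  | zero => simp
  | succ n ih =>
    rw [hstd] at ha
    induction ha using Submodule.mul_induction_on' with
    | mem_mul_mem b hb c hc =>
      rw [pow_succ]
      exact Ideal.mul_mem_mul (ih hb)
        (Ideal.subset_span (Set.mem_iUnion.2 ⟨0, hc⟩))
    | add x _ y _ hx hy => exact add_mem hx hy

theorem proj_eq_zero_of_mem_gradedMaxIdeal_pow (𝒜 : ℕ → Submodule K A) [GradedAlgebra 𝒜]
    {k n : ℕ} (hn : n < k) {a : A} (ha : a ∈ gradedMaxIdeal 𝒜 ^ k) :
    GradedAlgebra.proj 𝒜 n a = 0 := by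
  induction k generalizing n a with
  | zero => omega
  | succ k ih =>
    rw [pow_succ] at ha
    induction ha using Submodule.mul_induction_on' with
    | add x _ y _ hx hy => rw [map_add, hx, hy, add_zero]
    | mem_mul_mem b hb c hc =>
      unfold gradedMaxIdeal at hc
      induction hc using Submodule.span_induction generalizing b with
      | zero => simp
      | add x y _ _ hx hy => rw [mul_add, map_add, hx b hb, hy b hb, add_zero]
      | smul r x _ hx =>
        rw [smul_eq_mul, ← mul_assoc]
        exact hx _ (Ideal.mul_mem_right r _ hb)
      | mem x hx =>
        obtain ⟨i, hi⟩ := Set.mem_iUnion.1 hx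
        rw [GradedAlgebra.proj_apply]
        by_cases hin : i + 1 ≤ n
        · rw [DirectSum.coe_decompose_mul_of_right_mem_of_le 𝒜 hi hin,
            ← GradedAlgebra.proj_apply, ih (by omega) hb, zero_mul]
        · exact DirectSum.coe_decompose_mul_of_right_mem_of_not_le 𝒜 hi hin

/-- The projection of the graded free module onto its homogeneous piece of degree `n`. -/
def freeProj (𝒜 : ℕ → Submodule K A) [GradedAlgebra 𝒜] {s : ℕ} (d : Fin s → ℕ) (n : ℕ) :
    (Fin s → A) →ₗ[K] (Fin s → A) :=
  LinearMap.pi fun j =>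
    if d j ≤ n then GradedAlgebra.proj 𝒜 (n - d j) ∘ₗ LinearMap.proj j else 0

theorem freeProj_apply (𝒜 : ℕ → Submodule K A) [GradedAlgebra 𝒜] {s : ℕ} (d : Fin s → ℕ)
    (n : ℕ) (y : Fin s → A) (j : Fin s) :
    freeProj 𝒜 d n y j = if d j ≤ n then GradedAlgebra.proj 𝒜 (n - d j) (y j) else 0 := by
  simp only [freeProj, LinearMap.pi_apply]
  split_ifs <;> simp

theorem freeProj_of_mem (𝒜 : ℕ → Submodule K A) [GradedAlgebra 𝒜] {s : ℕ} {d : Fin s → ℕ}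
    {n : ℕ} {y : Fin s → A} (hy : y ∈ freeHomPiece 𝒜 d n) : freeProj 𝒜 d n y = y := by
  ext j
  have hj := mem_freeHomPiece.1 hy j
  rw [freeProj_apply]
  split_ifs at hj ⊢
  · rw [GradedAlgebra.proj_apply, DirectSum.decompose_of_mem_same 𝒜 hj]
  · exact ((Submodule.mem_bot K).1 hj).symm

theorem freeProj_smul_of_mem (𝒜 : ℕ → Submodule K A) [GradedAlgebra 𝒜] {s : ℕ}
    {d : Fin s → ℕ} {n t : ℕ} (a : A) {y : Fin s → A} (hy : y ∈ freeHomPiece 𝒜 d t) :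
    freeProj 𝒜 d n (a • y) = (if t ≤ n then GradedAlgebra.proj 𝒜 (n - t) a else 0) • y := by
  ext j
  have hj := mem_freeHomPiece.1 hy j
  rw [freeProj_apply, Pi.smul_apply, Pi.smul_apply, smul_eq_mul, smul_eq_mul]
  by_cases hdt : d j ≤ t
  · rw [if_pos hdt] at hj
    by_cases htn : t ≤ n
    · have hsub : n - d j - (t - d j) = n - t := by omega
      rw [if_pos (hdt.trans htn), if_pos htn, GradedAlgebra.proj_apply, GradedAlgebra.proj_apply,
        DirectSum.coe_decompose_mul_of_right_mem_of_le 𝒜 hj (by omega), hsub]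
    · rw [if_neg htn, zero_mul]
      split_ifs with hdn
      · rw [GradedAlgebra.proj_apply]
        exact DirectSum.coe_decompose_mul_of_right_mem_of_not_le 𝒜 hj (by omega)
      · rfl
  · rw [if_neg hdt, Submodule.mem_bot] at hj
    simp [hj]

theorem freeProj_mem_span (𝒜 : ℕ → Submodule K A) [GradedAlgebra 𝒜] {s : ℕ}
    {d : Fin s → ℕ} {S : Set (Fin s → A)} (hS : ∀ y ∈ S, ∃ t, y ∈ freeHomPiece 𝒜 d t)
    (n : ℕ) {y : Fin s → A} (hy : y ∈ span A S) : freeProj 𝒜 d n y ∈ span A S := by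
  induction hy using Submodule.closure_induction with
  | zero => simp
  | add x y _ _ hx hy => rw [map_add]; exact add_mem hx hy
  | smul_mem a y hy =>
    obtain ⟨t, ht⟩ := hS y hy
    rw [freeProj_smul_of_mem 𝒜 a ht]
    exact smul_mem _ _ (subset_span hy)

theorem freeProj_eq_zero (𝒜 : ℕ → Submodule K A) [GradedAlgebra 𝒜] {s : ℕ}
    (d : Fin s → ℕ) {n k : ℕ} (hn : n < k) {y : Fin s → A}
    (hy : ∀ j, y j ∈ gradedMaxIdeal 𝒜 ^ k) : freeProj 𝒜 d n y = 0 := by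
  ext j
  rw [freeProj_apply]
  split_ifs
  · exact proj_eq_zero_of_mem_gradedMaxIdeal_pow 𝒜 (by omega) (hy j)
  · rfl

theorem mem_ideal_smul_top_iff {R : Type*} [CommRing R] {ι : Type*} [Finite ι] (I : Ideal R)
    (y : ι → R) : y ∈ I • (⊤ : Submodule R (ι → R)) ↔ ∀ j, y j ∈ I := by
  constructor
  · intro hy j
    induction hy using Submodule.smul_induction_on' with
    | smul a ha z _ => exact Ideal.mul_mem_right _ _ ha
    | add x _ z _ hx hz => exact add_mem hx hz
  · classical
    have := Fintype.ofFinite ι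
    intro hy
    rw [pi_eq_sum_univ' y]
    exact sum_mem fun j _ => Submodule.smul_mem_smul (hy j) mem_top

/-- Graded Nakayama lemma for a submodule of a graded free module. -/
theorem eq_span_of_le_sup_smul (𝒜 : ℕ → Submodule K A) [GradedAlgebra 𝒜] {s : ℕ}
    {d : Fin s → ℕ} {S T : Set (Fin s → A)} (hS : ∀ y ∈ S, ∃ t, y ∈ freeHomPiece 𝒜 d t)
    (hT : ∀ y ∈ T, ∃ t, y ∈ freeHomPiece 𝒜 d t)
    (h : span A T ≤ span A S ⊔ gradedMaxIdeal 𝒜 • span A T) : span A T ≤ span A S := by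
  have hpow (k : ℕ) : span A T ≤ span A S ⊔ gradedMaxIdeal 𝒜 ^ k • span A T := by
    induction k with
    | zero => simp
    | succ k ih =>
      calc span A T ≤ span A S ⊔ gradedMaxIdeal 𝒜 • span A T := h
        _ ≤ span A S ⊔ gradedMaxIdeal 𝒜 •
            (span A S ⊔ gradedMaxIdeal 𝒜 ^ k • span A T) :=
          sup_le_sup_left (Submodule.smul_mono le_rfl ih) _
        _ ≤ span A S ⊔ gradedMaxIdeal 𝒜 ^ (k + 1) • span A T := by
          rw [Submodule.smul_sup, pow_succ', Submodule.mul_smul]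
          exact sup_le le_sup_left (sup_le_sup_right Submodule.smul_le_right _)
  refine span_le.2 fun y hy => ?_
  obtain ⟨n, hn⟩ := hT y hy
  obtain ⟨u, hu, v, hv, huv⟩ := Submodule.mem_sup.1 (hpow (n + 1) (subset_span hy))
  have hv0 : freeProj 𝒜 d n v = 0 := freeProj_eq_zero 𝒜 d n.lt_succ_self
    ((mem_ideal_smul_top_iff _ v).1 (Submodule.smul_mono le_rfl le_top hv))
  have hyu : y = freeProj 𝒜 d n u := by
    rw [← freeProj_of_mem 𝒜 hn, ← huv, map_add, hv0, add_zero]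
  rw [SetLike.mem_coe, hyu]
  exact freeProj_mem_span 𝒜 hS n hu

theorem exists_irredundant_span_eq {R M : Type*} [CommRing R] [AddCommGroup M] [Module R M]
    (S : Set M) (hS : (span R S).FG) :
    ∃ (t : ℕ) (x : Fin t → M), (∀ i, x i ∈ S) ∧ span R (Set.range x) = span R S ∧
      ∀ i, x i ∉ span R (x '' {j | j ≠ i}) := by
  classical
  obtain ⟨U, hUS, hU⟩ := (Submodule.fg_span_iff_fg_span_finset_subset S).1 hS
  obtain ⟨V, hVU, hV⟩ := exists_minimal_le_of_wellFoundedLT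
    (fun V : Finset M => span R (V : Set M) = span R S) U hU.symm
  refine ⟨V.card, fun i => V.equivFin.symm i, fun i => hUS (hVU (V.equivFin.symm i).2), ?_, ?_⟩
  · rw [← hV.prop]
    congr 1
    ext y
    simp only [Set.mem_range, Finset.mem_coe]
    exact ⟨by rintro ⟨i, rfl⟩; exact (V.equivFin.symm i).2,
      fun hy => ⟨V.equivFin ⟨y, hy⟩, by simp⟩⟩
  · intro i hi
    set z := V.equivFin.symm i
    have himage : (fun i => (V.equivFin.symm i : M)) '' {j | j ≠ i} ⊆ (V.erase z : Finset M) := by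
      rintro _ ⟨j, hj, rfl⟩
      rw [Finset.mem_coe, Finset.mem_erase]
      exact ⟨fun h => hj (V.equivFin.symm.injective (Subtype.ext h)), (V.equivFin.symm j).2⟩
    have hz' : (z : M) ∈ span R ((V.erase z : Finset M) : Set M) := span_mono himage hi
    have hspan : span R ((V.erase z : Finset M) : Set M) = span R S := by
      rw [← hV.prop]
      conv_rhs => rw [← Finset.insert_erase z.2, Finset.coe_insert]
      exact (span_insert_eq_span hz').symm
    exact Finset.notMem_erase _ _ (hV.le_of_le hspan (Finset.erase_subset _ _) z.2)

end

/-- Let `R` be a standard graded `K`-algebra, `F` a finitely generated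
graded free `R`-module with homogeneous basis `e_1, …, e_s` (of degrees `d_1, …, d_s`), and
`N ⊆ F` a graded submodule.  Then there exists a minimal set of homogeneous generators
`x_1, …, x_t` of `N` such that, writing `x_i = Σ_j a_{ij} e_j`, one has
`ρ(N, F) ≥ max_i min_j deg a_{ij}` (with `deg a = ∞` for `a = 0`); i.e. for every `i` there
is a `j` with `a_{ij} ≠ 0` and `deg a_{ij} = (deg x_i) - d_j ≤ ρ(N, F)`. -/
theorem statement5 {K A : Type*} [Field K] [CommRing A] [Algebra K A] [IsNoetherianRing A]
    (𝒜 : ℕ → Submodule K A) [GradedAlgebra 𝒜]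
    (hstd : ∀ n : ℕ, 𝒜 (n + 1) = 𝒜 n * 𝒜 1)
    {s : ℕ} (d : Fin s → ℕ) (N : Submodule A (Fin s → A))
    (hNgraded : ∃ T : Set (Fin s → A),
      (∀ y ∈ T, ∃ t : ℕ, y ∈ freeHomPiece 𝒜 d t) ∧ Submodule.span A T = N) :
    ∃ (t : ℕ) (x : Fin t → Fin s → A) (tdeg : Fin t → ℕ),
      (∀ i, x i ∈ freeHomPiece 𝒜 d (tdeg i)) ∧
      Submodule.span A (Set.range x) = N ∧
      (∀ i, x i ∉ Submodule.span A (x '' {j | j ≠ i})) ∧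
      ∀ i : Fin t, ∃ j : Fin s, x i j ≠ 0 ∧
        tdeg i - d j ≤ artinReesNumber (gradedMaxIdeal 𝒜) N ⊤ := by
  obtain ⟨T, hT, rfl⟩ := hNgraded
  set m := gradedMaxIdeal 𝒜
  set N := span A T
  set r := artinReesNumber m N ⊤ with hr
  let S : Set (Fin s → A) := {y | y ∈ N ∧ (∃ t, y ∈ freeHomPiece 𝒜 d t) ∧
    y ∉ m ^ (r + 1) • (⊤ : Submodule A (Fin s → A))}
  have hle : N ≤ span A S ⊔ m • N := by
    refine span_le.2 fun y hy => ?_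
    by_cases hym : y ∈ m ^ (r + 1) • (⊤ : Submodule A (Fin s → A))
    · have hy' : y ∈ N ⊓ m ^ (r + 1) • (⊤ : Submodule A (Fin s → A)) :=
        ⟨subset_span hy, hym⟩
      rw [artinReesNumber_spec m N (Nat.le_add_right r 1), ← hr, Nat.add_sub_cancel_left, pow_one] at hy'
      exact mem_sup_right (Submodule.smul_mono le_rfl inf_le_left hy')
    · exact mem_sup_left (subset_span ⟨subset_span hy, hT y hy, hym⟩)
  have hSN : span A S = N :=
    le_antisymm (span_le.2 fun y hy => hy.1)
      (eq_span_of_le_sup_smul 𝒜 (fun y hy => hy.2.1) hT hle)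
  obtain ⟨t, x, hxS, hx, hirr⟩ :=
    exists_irredundant_span_eq (R := A) S (IsNoetherian.noetherian _)
  choose tdeg htdeg using fun i => (hxS i).2.1
  refine ⟨t, x, tdeg, htdeg, hx.trans hSN, hirr, fun i => ?_⟩
  have hxi := (hxS i).2.2
  rw [mem_ideal_smul_top_iff] at hxi
  push Not at hxi
  obtain ⟨j, hj⟩ := hxi
  refine ⟨j, fun h => hj (h ▸ zero_mem _), ?_⟩
  by_contra! hlt
  have hxj := mem_freeHomPiece.1 (htdeg i) j
  rw [if_pos (by omega)] at hxj
  exact hj (Ideal.pow_le_pow_right hlt (mem_gradedMaxIdeal_pow 𝒜 hstd _ hxj))
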